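/- Fix d∈ℕ+. There exist 8-layer EUAF-transformer parameters Θ# with token dimension 4d+8 and at most 8 attention heads per layer such that: for every B≥1, L∈ℕ+, r⃗=(r_1,…,r_L)∈(ℕ∪{0})^L, U⊆B_d(B), every choice of weight matrices (W_1,…,W_L)∈W(r_1,d,U,B)×⋯×W(r_L,d,U,B), and every S ≥ max(d·r̄·B^{4L}, 2L) where r̄ = max_ℓ r_ℓ, there exists a prompt H^P∈P_U(T,L,S) with T = 2Σ_{ℓ∈[L]} r_ℓ such that for every N∈ℕ+ and z_1,…,z_N∈[0,1]^d, the tokens sequentially generated by TF_{Θ#} from the initial input [H^P, h^D(z_1,T+1,S),…,h^D(z_N,T+N,S)] satisfy, for all i∈[N] and ℓ∈[L], h_{T+Nℓ+i} = ((W_ℓ σ_EUAF(W_{ℓ−1} σ_EUAF(⋯σ_EUAF(W_1 z_i)⋯)))ᵀ, p(−ℓ, T+Nℓ+i, S)ᵀ)ᵀ. -/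

import Mathlib

open scoped BigOperators
open Matrix

noncomputable section

namespace PromptTF

/-- The ReLU activation function. -/
def relu (x : ℝ) : ℝ := max x 0

/-- The elementary universal activation function (EUAF). -/
def euaf (x : ℝ) : ℝ :=
  if 0 ≤ x then |x - 2 * (⌊(x + 1) / 2⌋ : ℝ)| else x / (1 + |x|)

/-- Parameters of one transformer layer (attention heads and a feed-forward net). -/
structure TFLayer (D : ℕ) where
  M : ℕ
  Q : Fin M → Matrix (Fin D) (Fin D) ℝ
  K : Fin M → Matrix (Fin D) (Fin D) ℝ
  V : Fin M → Matrix (Fin D) (Fin D) ℝ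
  width : ℕ
  W1 : Matrix (Fin width) (Fin D) ℝ
  W2 : Matrix (Fin D) (Fin width) ℝ

/-- Self-attention layer applied to a list of tokens. -/
def attnOut {D : ℕ} (θ : TFLayer D) (H : List (Fin D → ℝ)) : List (Fin D → ℝ) :=
  H.map fun h => fun i =>
    h i + ∑ m : Fin θ.M,
      (H.map fun h' =>
        relu (dotProduct ((θ.Q m).mulVec h) ((θ.K m).mulVec h')) * ((θ.V m).mulVec h') i).sum

/-- One transformer layer `FFN ∘ Attn`, with feed-forward activation `act`. -/
def layerMap {D : ℕ} (act : ℝ → ℝ) (θ : TFLayer D) (H : List (Fin D → ℝ)) :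
    List (Fin D → ℝ) :=
  (attnOut θ H).map fun h => fun i =>
    h i + (θ.W2.mulVec fun k => act ((θ.W1.mulVec h) k)) i

/-- Multi-layer transformer, all activations ReLU. -/
def tfForward {D : ℕ} (Θ : List (TFLayer D)) (H : List (Fin D → ℝ)) : List (Fin D → ℝ) :=
  Θ.foldl (fun H' θ => layerMap relu θ H') H

/-- Multi-layer transformer whose first feed-forward layer uses the EUAF activation. -/
def tfForwardEUAF {D : ℕ} (Θ : List (TFLayer D)) (H : List (Fin D → ℝ)) :
    List (Fin D → ℝ) :=
  match Θ with
  | [] => H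
  | θ :: rest => rest.foldl (fun H' θ' => layerMap relu θ' H') (layerMap euaf θ H)

/-- Sequential (autoregressive) generation: append the last output column repeatedly. -/
def genTokens {D : ℕ} (forward : List (Fin D → ℝ) → List (Fin D → ℝ))
    (H : List (Fin D → ℝ)) : ℕ → List (Fin D → ℝ)
  | 0 => H
  | v + 1 =>
      genTokens forward H v ++ [(forward (genTokens forward H v)).getLastD (fun _ => 0)]

/-- The token at one-based position `m` in the generated sequence. -/
def tokenAt {D : ℕ} (forward : List (Fin D → ℝ) → List (Fin D → ℝ))
    (H : List (Fin D → ℝ)) (m : ℕ) : Fin D → ℝ :=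
  (genTokens forward H (m - H.length)).getD (m - 1) (fun _ => 0)

/-- A token with word embedding `u`, layer index `w`, position `j` and scale `S`:
`(uᵀ, 0_{3d+4}ᵀ, 1, S, S·w, S·j)ᵀ ∈ ℝ^{4d+8}`. -/
def promptToken (d : ℕ) (u : Fin d → ℝ) (w : ℤ) (j : ℕ) (S : ℝ) : Fin (4 * d + 8) → ℝ :=
  fun i =>
    if h : (i : ℕ) < d then u ⟨i, h⟩
    else if (i : ℕ) = 4 * d + 4 then 1
    else if (i : ℕ) = 4 * d + 5 then S
    else if (i : ℕ) = 4 * d + 6 then S * w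
    else if (i : ℕ) = 4 * d + 7 then S * j
    else 0

/-- First `d` coordinates of a token. -/
def firstd (d : ℕ) (h : Fin (4 * d + 8) → ℝ) : Fin d → ℝ :=
  fun k => h (Fin.castLE (by omega) k)

/-- Initial input: `T` prompt tokens followed by `N` data tokens. -/
def initialInput (d T N : ℕ) (u : Fin T → Fin d → ℝ) (w : Fin T → ℕ) (S : ℝ)
    (z : Fin N → Fin d → ℝ) : List (Fin (4 * d + 8) → ℝ) :=
  ((List.finRange T).map fun j => promptToken d (u j) (w j) ((j : ℕ) + 1) S)
    ++ ((List.finRange N).map fun i => promptToken d (z i) 0 (T + (i : ℕ) + 1) S)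

/-- The closed Euclidean ball of radius `B` in `ℝ^d`. -/
def eball (d : ℕ) (B : ℝ) : Set (Fin d → ℝ) :=
  {v | Real.sqrt (∑ k, v k ^ 2) ≤ B}

/-- Data of a valid prompt in `P_U(T, L, S)`: word embeddings in `U`,
layer indices in `{1, …, 2L}`. -/
def ValidPrompt {d : ℕ} (U : Set (Fin d → ℝ)) (T L : ℕ)
    (u : Fin T → Fin d → ℝ) (w : Fin T → ℕ) : Prop :=
  (∀ j, u j ∈ U) ∧ ∀ j, 1 ≤ w j ∧ w j ≤ 2 * L

/-- The virtual weight matrix `W^P_ℓ` (without the first-layer correction term). -/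
def WPmat {d T : ℕ} (u : Fin T → Fin d → ℝ) (w : Fin T → ℕ) (ℓ : ℕ) :
    Matrix (Fin d) (Fin d) ℝ :=
  ∑ j : Fin T,
    if h : (j : ℕ) + 1 < T then
      (if w j = 2 * ℓ - 1 ∧ w ⟨(j : ℕ) + 1, h⟩ = 2 * ℓ then
        vecMulVec (u j) (u ⟨(j : ℕ) + 1, h⟩) else 0)
    else 0

/-- The first-layer correction term `(h_T)_{1:d} 1{w_T=1} Σ_{j'} (h_{j'})_{1:d}ᵀ 1{w_{j'}=1}`. -/
def WPcorr {d T : ℕ} (u : Fin T → Fin d → ℝ) (w : Fin T → ℕ) :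
    Matrix (Fin d) (Fin d) ℝ :=
  if hT : 0 < T then
    (if w ⟨T - 1, by omega⟩ = 1 then
      vecMulVec (u ⟨T - 1, by omega⟩) (∑ j : Fin T, if w j = 1 then u j else 0)
    else 0)
  else 0

/-- The virtual first-layer weight matrix `W^P_{1,i}`; `first` indicates `i = 1`. -/
def WPone {d T : ℕ} (u : Fin T → Fin d → ℝ) (w : Fin T → ℕ) (first : Bool) :
    Matrix (Fin d) (Fin d) ℝ :=
  WPmat u w 1 + if first then WPcorr u w else 0

/-- The family of virtual weight matrices of a prompt, for the data token with
zero-based index `i`. -/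
def WPfam {d T : ℕ} (u : Fin T → Fin d → ℝ) (w : Fin T → ℕ) (i : ℕ) :
    ℕ → Matrix (Fin d) (Fin d) ℝ :=
  fun ℓ => if ℓ = 1 then WPone u w (i == 0) else WPmat u w ℓ

/-- Output of the virtual network after `ℓ` layers:
`vnetOut … ℓ = W_ℓ act(W_{ℓ-1} act( ⋯ act(W_1 z) ⋯ ))`. -/
def vnetOut (d : ℕ) (act : ℝ → ℝ) (Ws : ℕ → Matrix (Fin d) (Fin d) ℝ)
    (z : Fin d → ℝ) : ℕ → Fin d → ℝ
  | 0 => z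
  | ℓ + 1 =>
      (Ws (ℓ + 1)).mulVec fun k =>
        if ℓ = 0 then vnetOut d act Ws z ℓ k else act (vnetOut d act Ws z ℓ k)

/-- The emulation property: for every admissible prompt and data tokens, the sequentially
generated tokens realize the virtual neural network encoded by the prompt
(with activation `act`). -/
def EmulatesWith (d : ℕ)
    (forward : List (Fin (4 * d + 8) → ℝ) → List (Fin (4 * d + 8) → ℝ))
    (act : ℝ → ℝ) : Prop :=
  ∀ B : ℝ, 1 ≤ B → ∀ T L : ℕ, 0 < T → 0 < L →
  ∀ U : Set (Fin d → ℝ), U ⊆ eball d B →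
  ∀ S : ℝ, max ((d : ℝ) * B ^ (4 * L) * (T : ℝ) ^ (2 * L)) (2 * (L : ℝ)) ≤ S →
  ∀ (u : Fin T → Fin d → ℝ) (w : Fin T → ℕ), ValidPrompt U T L u w →
  ∀ N : ℕ, 0 < N → ∀ z : Fin N → Fin d → ℝ, (∀ i k, z i k ∈ Set.Icc (0 : ℝ) 1) →
  ∀ (i : Fin N) (ℓ : ℕ), 1 ≤ ℓ → ℓ ≤ L →
    tokenAt forward (initialInput d T N u w S z) (T + N * ℓ + (i : ℕ) + 1)
      = promptToken d (vnetOut d act (WPfam u w (i : ℕ)) (z i) ℓ) (-(ℓ : ℤ))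
          (T + N * ℓ + (i : ℕ) + 1) S

/-- The embedding `x ↦ (xᵀ, 1, 0_{d-p-1}ᵀ)ᵀ ∈ ℝ^d` of an input `x ∈ ℝ^p`. -/
def embed (d p : ℕ) (x : Fin p → ℝ) : Fin d → ℝ :=
  fun k => if h : (k : ℕ) < p then x ⟨k, h⟩ else if (k : ℕ) = p then 1 else 0

/-- The function approximator `f̂_{Θ,H^P,L,p}`: first coordinate of the token at
position `T+1+L` generated from the prompt followed by the single data token. -/
def fhat {d : ℕ} (forward : List (Fin (4 * d + 8) → ℝ) → List (Fin (4 * d + 8) → ℝ))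
    {T : ℕ} (u : Fin T → Fin d → ℝ) (w : Fin T → ℕ) (S : ℝ) (L p : ℕ)
    (x : Fin p → ℝ) : ℝ :=
  tokenAt forward (initialInput d T 1 u w S fun _ => embed d p x) (T + 1 + L)
    ⟨0, by omega⟩

/-- The unit cube `[0,1]^p`. -/
def unitCube (p : ℕ) : Set (Fin p → ℝ) := Set.Icc 0 1

/-- The sup-distance `‖f - g‖_{L^∞([0,1]^p)}`. -/
def supDist (p : ℕ) (f g : (Fin p → ℝ) → ℝ) : ℝ :=
  ⨆ x : unitCube p, |f x.1 - g x.1|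

/-- Partial derivative (within the unit cube) in coordinate direction `i`. -/
def pderivW (p : ℕ) (i : Fin p) (f : (Fin p → ℝ) → ℝ) : (Fin p → ℝ) → ℝ :=
  fun x => fderivWithin ℝ f (unitCube p) x (Pi.single i 1)

/-- Iterated partial derivative along a list of coordinate directions. -/
def pderivList (p : ℕ) : List (Fin p) → ((Fin p → ℝ) → ℝ) → (Fin p → ℝ) → ℝ
  | [], f => f
  | i :: is, f => pderivList p is (pderivW p i f)

/-- The unit ball `C_u^β([0,1]^p)` of `β`-times continuously differentiable functions with
all partial derivatives of order `≤ β` bounded by `1` on the cube. -/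
def Hclass (p β : ℕ) : Set ((Fin p → ℝ) → ℝ) :=
  {f | ContDiffOn ℝ β f (unitCube p) ∧
    ∀ ls : List (Fin p), ls.length ≤ β →
      ∀ x ∈ unitCube p, |pderivList p ls f x| ≤ 1}

/-- `U_{d,r}` : the span of the first `r` standard basis vectors of `ℝ^d`. -/
def spanFirst (d r : ℕ) : Set (Fin d → ℝ) :=
  {v | ∀ k : Fin d, r ≤ (k : ℕ) → v k = 0}

/-- Hidden layers of a standard ReLU network of width `r` (with biases). -/
def nnHidden {p r : ℕ} (W0 : Matrix (Fin r) (Fin p) ℝ) (b0 : Fin r → ℝ)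
    (Wm : ℕ → Matrix (Fin r) (Fin r) ℝ) (bm : ℕ → Fin r → ℝ) (x : Fin p → ℝ) :
    ℕ → Fin r → ℝ
  | 0 => fun i => W0.mulVec x i + b0 i
  | k + 1 => fun i =>
      (Wm k).mulVec (fun j => relu (nnHidden W0 b0 Wm bm x k j)) i + bm k i

/-- The class `N(r,p,L)` of ReLU networks `ℝ^p → ℝ` of width `r` and depth `L`
(`L` affine maps with ReLU in between). -/
def NNclass (r p L : ℕ) : Set ((Fin p → ℝ) → ℝ) :=
  {f | if L = 1 then ∃ (a : Fin p → ℝ) (b : ℝ), f = fun x => (∑ i, a i * x i) + b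
    else ∃ (W0 : Matrix (Fin r) (Fin p) ℝ) (b0 : Fin r → ℝ)
      (Wm : ℕ → Matrix (Fin r) (Fin r) ℝ) (bm : ℕ → Fin r → ℝ)
      (wL : Fin r → ℝ) (bL : ℝ),
      f = fun x => (∑ j, wL j * relu (nnHidden W0 b0 Wm bm x (L - 2) j)) + bL}

/-- Operator norm (w.r.t. the Euclidean norm) of a `d × d` matrix. -/
def opNorm {d : ℕ} (W : Matrix (Fin d) (Fin d) ℝ) : ℝ :=
  ‖LinearMap.toContinuousLinearMap (Matrix.toEuclideanLin W)‖

/-- The class `W(r,d,U,B)` of coarse weight matrices. -/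
def coarseW (d r : ℕ) (U : Set (Fin d → ℝ)) (B : ℝ) :
    Set (Matrix (Fin d) (Fin d) ℝ) :=
  {W | (∃ ut uu : Fin r → Fin d → ℝ,
        (∀ k, ut k ∈ U) ∧ (∀ k, uu k ∈ U) ∧ W = ∑ k, vecMulVec (ut k) (uu k)) ∧
    opNorm W ≤ B ^ 2}

open Classical in
/-- Number of nonzero parameter entries of one transformer layer. -/
def layerNonzero {D : ℕ} (θ : TFLayer D) : ℕ :=
  (Finset.univ.filter fun p : Fin θ.M × Fin D × Fin D => θ.Q p.1 p.2.1 p.2.2 ≠ 0).card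
  + (Finset.univ.filter fun p : Fin θ.M × Fin D × Fin D => θ.K p.1 p.2.1 p.2.2 ≠ 0).card
  + (Finset.univ.filter fun p : Fin θ.M × Fin D × Fin D => θ.V p.1 p.2.1 p.2.2 ≠ 0).card
  + (Finset.univ.filter fun p : Fin θ.width × Fin D => θ.W1 p.1 p.2 ≠ 0).card
  + (Finset.univ.filter fun p : Fin D × Fin θ.width => θ.W2 p.1 p.2 ≠ 0).card

/-- Total number of nonzero parameter entries of a transformer. -/
def tfNonzero {D : ℕ} (Θ : List (TFLayer D)) : ℕ := (Θ.map layerNonzero).sum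

/-- All parameter entries of one layer bounded in absolute value by `c`. -/
def layerEntriesBounded {D : ℕ} (θ : TFLayer D) (c : ℝ) : Prop :=
  (∀ m i j, |θ.Q m i j| ≤ c) ∧ (∀ m i j, |θ.K m i j| ≤ c) ∧ (∀ m i j, |θ.V m i j| ≤ c)
  ∧ (∀ i j, |θ.W1 i j| ≤ c) ∧ ∀ i j, |θ.W2 i j| ≤ c

end PromptTF
end

open PromptTF Matrix

namespace PromptTF

variable {d : ℕ}

/-- The coordinates of a token, split into four blocks of length `d` and eight scalars. -/
def coordEquiv (d : ℕ) : (Fin 4 × Fin d) ⊕ Fin 8 ≃ Fin (4 * d + 8) :=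
  (Equiv.sumCongr finProdFinEquiv (Equiv.refl _)).trans finSumFinEquiv

/-- Coordinate `k` of block `a` of a token. -/
def blk (h : Fin (4 * d + 8) → ℝ) (a : Fin 4) (k : Fin d) : ℝ := h (coordEquiv d (.inl (a, k)))

/-- Scalar number `s` of a token. -/
def scal (h : Fin (4 * d + 8) → ℝ) (s : Fin 8) : ℝ := h (coordEquiv d (.inr s))

/-- The token with given blocks and scalars. -/
def mkTok (b : Fin 4 → Fin d → ℝ) (x : Fin 8 → ℝ) : Fin (4 * d + 8) → ℝ :=
  fun i => Sum.elim (fun q => b q.1 q.2) x ((coordEquiv d).symm i)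

@[simp] lemma blk_mkTok (b : Fin 4 → Fin d → ℝ) (x : Fin 8 → ℝ) (a : Fin 4) (k : Fin d) :
    blk (mkTok b x) a k = b a k := by simp [blk, mkTok]

@[simp] lemma blk_mkTok' (b : Fin 4 → Fin d → ℝ) (x : Fin 8 → ℝ) (a : Fin 4) :
    blk (mkTok b x) a = b a := funext (blk_mkTok b x a)

@[simp] lemma scal_mkTok (b : Fin 4 → Fin d → ℝ) (x : Fin 8 → ℝ) (s : Fin 8) :
    scal (mkTok b x) s = x s := by simp [scal, mkTok]

@[simp] lemma blk_add (h h' : Fin (4 * d + 8) → ℝ) (a : Fin 4) (k : Fin d) :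
    blk (h + h') a k = blk h a k + blk h' a k := rfl

@[simp] lemma blk_smul (c : ℝ) (h : Fin (4 * d + 8) → ℝ) (a : Fin 4) (k : Fin d) :
    blk (c • h) a k = c * blk h a k := rfl

@[simp] lemma scal_add (h h' : Fin (4 * d + 8) → ℝ) (s : Fin 8) :
    scal (h + h') s = scal h s + scal h' s := rfl

@[simp] lemma scal_smul (c : ℝ) (h : Fin (4 * d + 8) → ℝ) (s : Fin 8) :
    scal (c • h) s = c * scal h s := rfl

@[simp] lemma blk_sum {α : Type*} (t : Finset α) (f : α → Fin (4 * d + 8) → ℝ) (a : Fin 4)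
    (k : Fin d) : blk (∑ j ∈ t, f j) a k = ∑ j ∈ t, blk (f j) a k := by simp [blk]

@[simp] lemma scal_sum {α : Type*} (t : Finset α) (f : α → Fin (4 * d + 8) → ℝ) (s : Fin 8) :
    scal (∑ j ∈ t, f j) s = ∑ j ∈ t, scal (f j) s := by simp [scal]

lemma tok_ext {h h' : Fin (4 * d + 8) → ℝ} (hb : ∀ a k, blk h a k = blk h' a k)
    (hs : ∀ s, scal h s = scal h' s) : h = h' := by
  funext i
  obtain ⟨i, rfl⟩ := (coordEquiv d).surjective i
  rcases i with ⟨a, k⟩ | s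
  · exact hb a k
  · exact hs s

lemma promptToken_eq_mkTok (u : Fin d → ℝ) (w : ℤ) (j : ℕ) (S : ℝ) :
    promptToken d u w j S = mkTok ![u, 0, 0, 0] ![0, 0, 0, 0, 1, S, S * w, S * j] := by
  refine tok_ext (fun a k => ?_) (fun s => ?_)
  · rw [blk_mkTok]
    have hk := k.2
    fin_cases a <;> simp [blk, promptToken, coordEquiv]
    all_goals repeat' rw [if_neg (by omega)]
    all_goals rw [dif_neg (by omega)]
  · rw [scal_mkTok]
    have : ¬ (4 * d + (s : ℕ) < d) := by omega
    fin_cases s <;> simp [scal, promptToken, coordEquiv] <;> omega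

lemma _root_.IsLinearMap.apply_eq_dotProduct {D : ℕ} {g : (Fin D → ℝ) → ℝ}
    (hg : IsLinearMap ℝ g) (h : Fin D → ℝ) :
    g h = dotProduct (fun j => g (Pi.single j 1)) h := by
  have h1 := (hg.mk' g).pi_apply_eq_sum_univ h
  simp only [IsLinearMap.mk'_apply, smul_eq_mul] at h1
  rw [h1, dotProduct]
  refine Finset.sum_congr rfl fun i _ => ?_
  rw [mul_comm]
  congr 2
  funext j
  simp [Pi.single_apply, eq_comm]

/-- Functions of a token spanned by single neurons with activation `act`. -/
def neuronSpan (act : ℝ → ℝ) (D : ℕ) : Submodule ℝ ((Fin D → ℝ) → ℝ) :=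
  Submodule.span ℝ (Set.range fun (φ : (Fin D → ℝ) →ₗ[ℝ] ℝ) h => act (φ h))

lemma neuron_mem {D : ℕ} (act : ℝ → ℝ) {g : (Fin D → ℝ) → ℝ} (hg : IsLinearMap ℝ g) :
    (fun h => act (g h)) ∈ neuronSpan act D :=
  Submodule.subset_span ⟨hg.mk', rfl⟩

lemma linear_mem_neuronSpan {D : ℕ} {g : (Fin D → ℝ) → ℝ} (hg : IsLinearMap ℝ g) :
    g ∈ neuronSpan relu D := by
  have h1 := neuron_mem relu hg
  have h2 := neuron_mem relu (g := fun h => - g h)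
    ⟨fun x y => by simp only [hg.map_add]; ring, fun c x => by simp [hg.map_smul]⟩
  convert sub_mem h1 h2 using 1
  funext h
  simp [relu, max_zero_sub_max_neg_zero_eq_self]

lemma exists_feedForward {D : ℕ} {act : ℝ → ℝ} {G : (Fin D → ℝ) → Fin D → ℝ}
    (hG : ∀ i, (fun h => G h i - h i) ∈ neuronSpan act D) :
    ∃ (width : ℕ) (W1 : Matrix (Fin width) (Fin D) ℝ) (W2 : Matrix (Fin D) (Fin width) ℝ),
      ∀ h i, h i + (W2.mulVec fun k => act ((W1.mulVec h) k)) i = G h i := by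
  classical
  have h1 : ∀ i, ∃ c : ((Fin D → ℝ) →ₗ[ℝ] ℝ) →₀ ℝ,
      (c.sum fun φ a => a • fun h => act (φ h)) = fun h => G h i - h i := fun i =>
    Finsupp.mem_span_range_iff_exists_finsupp.1 (hG i)
  choose c hc using h1
  let s := Finset.univ.biUnion fun i => (c i).support
  refine ⟨s.card, Matrix.of fun k j => (s.equivFin.symm k).1 (Pi.single j 1),
    Matrix.of fun i k => c i (s.equivFin.symm k).1, fun h i => ?_⟩
  have h2 : ∀ k, (Matrix.mulVec (Matrix.of fun (k : Fin s.card) (j : Fin D) =>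
      (s.equivFin.symm k).1 (Pi.single j 1)) h) k = (s.equivFin.symm k).1 h := by
    intro k
    exact ((s.equivFin.symm k).1.isLinear.apply_eq_dotProduct h).symm
  have h3 := congrFun (hc i) h
  rw [Finsupp.sum_of_support_subset (s := s) _
    (Finset.subset_biUnion_of_mem (fun i => (c i).support) (Finset.mem_univ i)) _ (by simp),
    Finset.sum_apply] at h3
  rw [← eq_sub_iff_add_eq', ← h3]
  simp only [h2]
  rw [← Finset.sum_coe_sort, ← s.equivFin.symm.sum_comp]
  simp [Matrix.mulVec, dotProduct]

lemma exists_layer {D M : ℕ} {act : ℝ → ℝ} (β : Fin M → (Fin D → ℝ) → (Fin D → ℝ) → ℝ)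
    (hβ₁ : ∀ m h', IsLinearMap ℝ fun h => β m h h') (hβ₂ : ∀ m h, IsLinearMap ℝ (β m h))
    (v : Fin M → (Fin D → ℝ) → Fin D → ℝ) (hv : ∀ m, IsLinearMap ℝ (v m))
    (G : (Fin D → ℝ) → Fin D → ℝ)
    (hG : ∀ i, (fun h => G h i - h i) ∈ neuronSpan act D) :
    ∃ θ : TFLayer D, θ.M = M ∧ ∀ (n : ℕ) (f g f' : ℕ → Fin D → ℝ),
      (∀ p < n, f p + ∑ m, ∑ p' ∈ Finset.range n, relu (β m (f p) (f p')) • v m (f p') = g p) →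
      (∀ p < n, G (g p) = f' p) →
      layerMap act θ ((List.range n).map f) = (List.range n).map f' := by
  obtain ⟨width, W1, W2, hW⟩ := exists_feedForward hG
  refine ⟨⟨M, fun m => Matrix.of fun i j => β m (Pi.single j 1) (Pi.single i 1), fun _ => 1,
    fun m => (hv m).mk'.toMatrix', width, W1, W2⟩, rfl, fun n f g f' hg hf' => ?_⟩
  have hQ : ∀ m h h', dotProduct (Matrix.mulVec
      (Matrix.of fun i j => β m (Pi.single j 1) (Pi.single i 1)) h) h' = β m h h' := by
    intro m h h'
    rw [(hβ₂ m h).apply_eq_dotProduct h']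
    congr 1
    funext i
    exact ((hβ₁ m _).apply_eq_dotProduct h).symm
  have hV : ∀ m h, ((hv m).mk'.toMatrix').mulVec h = v m h := fun m h => by
    simp
  simp only [layerMap, attnOut, List.map_map]
  refine List.map_congr_left fun p hp => ?_
  rw [List.mem_range] at hp
  rw [← hf' p hp, ← hg p hp]
  funext i
  simp only [Function.comp_apply, hW, Matrix.one_mulVec, hQ, hV]
  congr 1
  funext i
  simp only [Pi.add_apply, Finset.sum_apply, Pi.smul_apply, smul_eq_mul]
  rfl

lemma neuronSpan_of_coords {act : ℝ → ℝ}
    {G : (Fin (4 * d + 8) → ℝ) → Fin (4 * d + 8) → ℝ}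
    (hb : ∀ a k, (fun h => blk (G h) a k - blk h a k) ∈ neuronSpan act (4 * d + 8))
    (hs : ∀ s, (fun h => scal (G h) s - scal h s) ∈ neuronSpan act (4 * d + 8)) (i) :
    (fun h => G h i - h i) ∈ neuronSpan act (4 * d + 8) := by
  obtain ⟨i, rfl⟩ := (coordEquiv d).surjective i
  rcases i with ⟨a, k⟩ | s
  · exact hb a k
  · exact hs s

lemma relu_hat {S : ℝ} (hS : 0 ≤ S) (t : ℤ) :
    relu (S * t + S) - 2 * relu (S * t) + relu (S * t - S) = if t = 0 then S else 0 := by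
  unfold relu
  rcases lt_trichotomy t 0 with h | rfl | h
  · have : (t : ℝ) ≤ -1 := by exact_mod_cast (show t ≤ -1 by omega)
    rw [max_eq_right (by nlinarith), max_eq_right (by nlinarith), max_eq_right (by nlinarith),
      if_neg h.ne]
    simp
  · simp [hS]
  · have : (1 : ℝ) ≤ t := by exact_mod_cast (show 1 ≤ t by omega)
    rw [max_eq_left (by nlinarith), max_eq_left (by nlinarith), max_eq_left (by nlinarith),
      if_neg h.ne']
    ring

lemma relu_sub_relu_neg (x : ℝ) : relu x - relu (-x) = x := by
  simp [relu, max_zero_sub_max_neg_zero_eq_self]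

lemma relu_gate {x S : ℝ} (hx : |x| ≤ S) (p : Prop) [Decidable p] :
    relu (x - S + 2 * (if p then S else 0)) - (if p then S else 0) = if p then x else 0 := by
  obtain ⟨h1, h2⟩ := abs_le.1 hx
  unfold relu
  split_ifs
  · rw [max_eq_left (by linarith)]; ring
  · rw [max_eq_right (by linarith)]; ring

lemma euaf_abs_le (x : ℝ) : |euaf x| ≤ 1 := by
  unfold euaf
  split_ifs with h
  · have h1 := Int.floor_le ((x + 1) / 2)
    have h2 := Int.lt_floor_add_one ((x + 1) / 2)
    rw [abs_abs, abs_le]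
    constructor <;> linarith
  · rw [abs_div, abs_of_pos (show 0 < 1 + |x| by positivity), div_le_one (by positivity)]
    linarith

lemma euaf_of_mem_Icc {x : ℝ} (hx : x ∈ Set.Icc (0 : ℝ) 1) : euaf x = x := by
  obtain ⟨h0, h1⟩ := hx
  rw [euaf, if_pos h0]
  rcases h1.eq_or_lt with rfl | h1
  · norm_num
  · rw [Int.floor_eq_zero_iff.2 ⟨by linarith, by linarith⟩]
    simp [abs_of_nonneg h0]

lemma euaf_one_sub {S : ℝ} (hS : 2 ≤ S) : euaf (1 - S) + euaf 1 = S⁻¹ := by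
  rw [euaf_of_mem_Icc (x := 1) (by simp), euaf, if_neg (by linarith), abs_of_neg (by linarith)]
  have : S ≠ 0 := by linarith
  rw [show 1 + -(1 - S) = S by ring]
  field_simp
  ring

/-- Closes goals asserting that an explicit map of tokens is linear. -/
local notation "linmap" => (⟨by intros; simp; try ring, by intros; simp; try ring⟩)

theorem exists_activation_layer (d : ℕ) : ∃ θ : TFLayer (4 * d + 8), θ.M = 4 ∧
    ∀ (n : ℕ) (S : ℝ) (U : ℕ → Fin d → ℝ) (w : ℕ → ℤ), 2 ≤ S →
      layerMap euaf θ ((List.range n).map fun p =>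
        mkTok ![U p, 0, 0, 0] ![0, 0, 0, 0, 1, S, S * w p, S * (p + 1)]) =
      (List.range n).map fun p =>
        mkTok ![U p, fun k => euaf (U p k), 0, 0]
          ![S * (n - ((Finset.range n).filter fun p => w p = 0).card), S⁻¹, 0, 0,
            1, S, S * w p, S * (p + 1)] := by
  obtain ⟨θ, hM, hθ⟩ := exists_layer (D := 4 * d + 8) (M := 4) (act := euaf)
    (fun m h h' => scal h 4 *
      ((![1, 1, 0, -1] : Fin 4 → ℝ) m * scal h' 5 + (![0, 1, 1, 1] : Fin 4 → ℝ) m * scal h' 6))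
    (fun m h' => linmap) (fun m h => linmap)
    (fun m h' => mkTok 0 ![(![1, -1, 2, -1] : Fin 4 → ℝ) m * scal h' 4, 0, 0, 0, 0, 0, 0, 0])
    (fun m => by
      refine ⟨fun x y => tok_ext (by simp) fun s => ?_, fun c x => tok_ext (by simp) fun s => ?_⟩
        <;> fin_cases s <;> simp <;> ring)
    (fun h => mkTok ![blk h 0, fun k => blk h 1 k + euaf (blk h 0 k), blk h 2, blk h 3]
      ![scal h 0, scal h 1 + (euaf (scal h 4 - scal h 5) + euaf (scal h 4)), scal h 2, scal h 3,
        scal h 4, scal h 5, scal h 6, scal h 7])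
    (neuronSpan_of_coords (by
      intro a k
      fin_cases a <;> simp [← Pi.zero_def, zero_mem]
      exact neuron_mem euaf linmap) (by
      intro s
      fin_cases s <;> simp [← Pi.zero_def, zero_mem]
      exact add_mem (neuron_mem euaf linmap) (neuron_mem euaf linmap)))
  refine ⟨θ, hM, fun n S U w hS => hθ n _ (fun p => mkTok ![U p, 0, 0, 0]
    ![S * (n - ((Finset.range n).filter fun p => w p = 0).card), 0, 0, 0, 1, S, S * w p,
      S * (p + 1)]) _ (fun p _ => tok_ext (fun a k => ?_) fun s => ?_)
    fun p _ => tok_ext (fun a k => ?_) fun s => ?_⟩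
  · fin_cases a <;> simp
  · have h1 := Finset.sum_congr rfl fun p (_ : p ∈ Finset.range n) =>
      relu_hat (show 0 ≤ S by linarith) (w p)
    simp only [Finset.sum_add_distrib, Finset.sum_sub_distrib, ← Finset.mul_sum,
      ← Finset.sum_filter, Finset.sum_const, nsmul_eq_mul] at h1
    have h2 : relu S = S := max_eq_left (by linarith)
    simp only [Fin.sum_univ_four, scal_add, scal_sum, scal_smul, scal_mkTok]
    fin_cases s <;> simp
    simp only [← Finset.sum_mul, h2, add_comm S, neg_add_eq_sub]
    linarith
  · fin_cases a <;> simp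
  · fin_cases s <;> simp
    exact euaf_one_sub hS

theorem exists_flag_layer (d : ℕ) : ∃ θ : TFLayer (4 * d + 8), θ.M = 0 ∧
    ∀ (n s : ℕ) (S q : ℝ) (U A : ℕ → Fin d → ℝ) (w : ℕ → ℝ), 0 ≤ S →
      layerMap relu θ ((List.range n).map fun p =>
        mkTok ![U p, A p, 0, 0] ![S * s, q, 0, 0, 1, S, w p, S * (p + 1)]) =
      (List.range n).map fun p =>
        mkTok ![U p, A p, 0, 0]
          ![if p = s then S else 0, q, 0, 0, 1, S, w p, S * (p + 1)] := by
  obtain ⟨θ, hM, hθ⟩ := exists_layer (D := 4 * d + 8) (M := 0) (act := relu)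
    (fun m h h' => 0) (fun m h' => linmap) (fun m h => linmap)
    (fun m h' => 0) (fun m => ⟨by simp, by simp⟩)
    (fun h => mkTok (blk h)
      ![relu (scal h 0 + 2 * scal h 5 - scal h 7) - 2 * relu (scal h 0 + scal h 5 - scal h 7)
          + relu (scal h 0 - scal h 7), scal h 1, scal h 2, scal h 3,
        scal h 4, scal h 5, scal h 6, scal h 7])
    (neuronSpan_of_coords (by
      intro a k
      simp [← Pi.zero_def, zero_mem]) (by
      intro s
      fin_cases s <;> simp [← Pi.zero_def, zero_mem]
      exact sub_mem (add_mem (sub_mem (neuron_mem relu linmap)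
        (Submodule.smul_mem _ (2 : ℝ) (neuron_mem relu linmap))) (neuron_mem relu linmap))
        (linear_mem_neuronSpan linmap)))
  refine ⟨θ, hM, fun n s S q U A w hS => hθ n _ _ _ (fun p _ => by simp; rfl)
    fun p _ => tok_ext (fun a k => ?_) fun i => ?_⟩
  · simp
  · fin_cases i <;> simp
    have h1 := relu_hat hS ((s : ℤ) - p)
    simp only [sub_eq_zero, Nat.cast_inj, eq_comm (a := s)] at h1
    rw [← h1]
    push_cast
    ring_nf

theorem exists_source_layer (d : ℕ) : ∃ θ : TFLayer (4 * d + 8), θ.M = 1 ∧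
    ∀ (n s : ℕ) (S : ℝ) (U A : ℕ → Fin d → ℝ) (w : ℕ → ℤ) (j : ℕ → ℝ), 2 ≤ S → s < n →
      (∀ p < n, ∀ k, |A p k| ≤ S) →
      layerMap relu θ ((List.range n).map fun p =>
        mkTok ![U p, A p, 0, 0] ![if p = s then S else 0, S⁻¹, 0, 0, 1, S, S * w p, j p]) =
      (List.range n).map fun p =>
        mkTok ![U p, if p = s then A s else 0, 0, 0]
          ![if w p + 2 * w s - 1 = 0 then S else 0, S⁻¹, 0, S * w s, 1, S, S * w p, j p] := by
  obtain ⟨θ, hM, hθ⟩ := exists_layer (D := 4 * d + 8) (M := 1) (act := relu)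
    (fun m h h' => scal h 1 * scal h' 0) (fun m h' => linmap) (fun m h => linmap)
    (fun m h' => mkTok 0 ![0, 0, 0, scal h' 6, 0, 0, 0, 0])
    (fun m => by
      refine ⟨fun x y => tok_ext (by simp) fun s => ?_, fun c x => tok_ext (by simp) fun s => ?_⟩
        <;> fin_cases s <;> simp)
    (fun h => mkTok ![blk h 0, fun k => relu (blk h 1 k - scal h 5 + 2 * scal h 0) - scal h 0,
        blk h 2, blk h 3]
      ![relu (scal h 6 + 2 * scal h 3) - 2 * relu (scal h 6 + 2 * scal h 3 - scal h 5)
          + relu (scal h 6 + 2 * scal h 3 - 2 * scal h 5), scal h 1, scal h 2, scal h 3,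
        scal h 4, scal h 5, scal h 6, scal h 7])
    (neuronSpan_of_coords (by
      intro a k
      fin_cases a <;> simp [← Pi.zero_def, zero_mem]
      exact sub_mem (sub_mem (neuron_mem relu linmap) (linear_mem_neuronSpan linmap))
        (linear_mem_neuronSpan linmap)) (by
      intro s
      fin_cases s <;> simp [← Pi.zero_def, zero_mem]
      exact sub_mem (add_mem (sub_mem (neuron_mem relu linmap)
        (Submodule.smul_mem _ (2 : ℝ) (neuron_mem relu linmap))) (neuron_mem relu linmap))
        (linear_mem_neuronSpan linmap)))
  refine ⟨θ, hM, fun n s S U A w j hS hs hA => hθ n _ (fun p => mkTok ![U p, A p, 0, 0]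
    ![if p = s then S else 0, S⁻¹, 0, S * w s, 1, S, S * w p, j p]) _
    (fun p _ => tok_ext (fun a k => ?_) fun i => ?_)
    fun p hp => tok_ext (fun a k => ?_) fun i => ?_⟩
  · fin_cases a <;> simp
  · have hS0 : S ≠ 0 := by linarith
    fin_cases i <;> simp
    rw [Finset.sum_eq_single_of_mem s (Finset.mem_range.2 hs)]
    · simp [relu, hS0]
    · intro p _ hp
      simp [relu, hp]
  · simp only [blk_mkTok, blk_mkTok', scal_mkTok]
    fin_cases a
    · rfl
    · refine (relu_gate (hA p hp k) (p = s)).trans ?_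
      by_cases h : p = s <;> simp [h]
    · rfl
    · rfl
  · fin_cases i <;> simp
    have h1 := relu_hat (show 0 ≤ S by linarith) (w p + 2 * w s - 1)
    rw [← h1]
    push_cast
    ring_nf

theorem exists_inner_layer (d : ℕ) : ∃ θ : TFLayer (4 * d + 8), θ.M = 2 ∧
    ∀ (n s : ℕ) (S : ℝ) (U : ℕ → Fin d → ℝ) (a : Fin d → ℝ) (e : ℕ → Prop) [DecidablePred e]
      (q g : ℝ) (w j : ℕ → ℝ), 0 ≤ S → s < n → (∀ p < n, ∀ k, |U p k| ≤ S) →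
      layerMap relu θ ((List.range n).map fun p =>
        mkTok ![U p, if p = s then a else 0, 0, 0]
          ![if e p then S else 0, q, 0, g, 1, S, w p, j p]) =
      (List.range n).map fun p =>
        mkTok ![U p, if p = s then a else 0, if e p then U p else 0, 0]
          ![0, q, ∑ k, U p k * a k, g, 1, S, w p, j p] := by
  obtain ⟨θ, hM, hθ⟩ := exists_layer (D := 4 * d + 8) (M := 2) (act := relu)
    (fun m h h' => (![1, -1] : Fin 2 → ℝ) m * ∑ k, blk h 0 k * blk h' 1 k)
    (fun m h' => ⟨by intros; simp [add_mul, Finset.sum_add_distrib]; ring,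
      by intros; simp [mul_assoc, ← Finset.mul_sum]; ring⟩)
    (fun m h => ⟨by intros; simp [mul_add, Finset.sum_add_distrib],
      by intros; simp [mul_left_comm, ← Finset.mul_sum]⟩)
    (fun m h' => mkTok 0 ![0, 0, (![1, -1] : Fin 2 → ℝ) m * scal h' 4, 0, 0, 0, 0, 0])
    (fun m => by
      refine ⟨fun x y => tok_ext (by simp) fun s => ?_, fun c x => tok_ext (by simp) fun s => ?_⟩
        <;> fin_cases s <;> simp <;> ring)
    (fun h => mkTok ![blk h 0, blk h 1,
        fun k => blk h 2 k + (relu (blk h 0 k - scal h 5 + 2 * scal h 0) - scal h 0), blk h 3]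
      ![0, scal h 1, scal h 2, scal h 3, scal h 4, scal h 5, scal h 6, scal h 7])
    (neuronSpan_of_coords (by
      intro a k
      fin_cases a <;> simp [← Pi.zero_def, zero_mem]
      exact sub_mem (neuron_mem relu linmap) (linear_mem_neuronSpan linmap)) (by
      intro s
      fin_cases s <;> simp [← Pi.zero_def, zero_mem]
      exact linear_mem_neuronSpan linmap))
  refine ⟨θ, hM, fun n s S U a e _ q g w j hS hs hU => hθ n _ (fun p => mkTok
    ![U p, if p = s then a else 0, 0, 0]
    ![if e p then S else 0, q, ∑ k, U p k * a k, g, 1, S, w p, j p]) _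
    (fun p _ => tok_ext (fun a k => ?_) fun i => ?_)
    fun p hp => tok_ext (fun a k => ?_) fun i => ?_⟩
  · fin_cases a <;> simp
  · simp only [Fin.sum_univ_two]
    fin_cases i <;> simp
    simp only [← sub_eq_add_neg, ← Finset.sum_sub_distrib, relu_sub_relu_neg]
    rw [Finset.sum_eq_single_of_mem s (Finset.mem_range.2 hs)]
    · simp
    · intro p _ hp
      simp [hp]
  · simp only [blk_mkTok, blk_mkTok', scal_mkTok]
    fin_cases a
    · rfl
    · rfl
    · refine (zero_add _).trans ((relu_gate (hU p hp k) (e p)).trans ?_)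
      by_cases h : e p <;> simp [h]
    · rfl
  · fin_cases i <;> simp

theorem exists_shift_layer (d : ℕ) : ∃ θ : TFLayer (4 * d + 8), θ.M = 3 ∧
    ∀ (n : ℕ) (S : ℝ) (U A V : ℕ → Fin d → ℝ) (x w : ℕ → ℝ) (q g : ℝ), 0 ≤ S →
      layerMap relu θ ((List.range n).map fun p =>
        mkTok ![U p, A p, V p, 0] ![0, q, x p, g, 1, S, w p, S * (p + 1)]) =
      (List.range n).map fun p =>
        mkTok ![U p, A p, V p, 0]
          ![if p + 1 < n then S * x (p + 1) else 0, q, x p, g, 1, S, w p, S * (p + 1)] := by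
  obtain ⟨θ, hM, hθ⟩ := exists_layer (D := 4 * d + 8) (M := 3) (act := relu)
    (fun m h h' => scal h 4 * scal h' 7 - scal h 7 * scal h' 4
      - (![0, 1, 2] : Fin 3 → ℝ) m * scal h 5 * scal h' 4)
    (fun m h' => linmap) (fun m h => linmap)
    (fun m h' => mkTok 0 ![(![1, -2, 1] : Fin 3 → ℝ) m * scal h' 2, 0, 0, 0, 0, 0, 0, 0])
    (fun m => by
      refine ⟨fun x y => tok_ext (by simp) fun s => ?_, fun c x => tok_ext (by simp) fun s => ?_⟩
        <;> fin_cases s <;> simp <;> ring)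
    id (by simp [← Pi.zero_def, zero_mem])
  refine ⟨θ, hM, fun n S U A V x w q g hS => hθ n _ (fun p => mkTok ![U p, A p, V p, 0]
    ![if p + 1 < n then S * x (p + 1) else 0, q, x p, g, 1, S, w p, S * (p + 1)]) _
    (fun p _ => tok_ext (fun a k => ?_) fun i => ?_) fun p hp => rfl⟩
  · fin_cases a <;> simp
  · simp only [Fin.sum_univ_three]
    fin_cases i <;> simp
    have h1 : ∀ p' : ℕ, (if p' = p + 1 then S * x p' else 0) =
        relu (S * (p' + 1) - S * (p + 1)) * x p'
        + relu (S * (p' + 1) - S * (p + 1) - S) * (-2 * x p')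
        + relu (S * (p' + 1) - S * (p + 1) - 2 * S) * x p' := by
      intro p'
      have h2 := relu_hat hS ((p' : ℤ) - (p + 1 : ℕ))
      simp only [sub_eq_zero, Nat.cast_inj] at h2
      rw [← ite_zero_mul, ← h2]
      push_cast
      ring_nf
    have h3 := Finset.sum_congr rfl fun p' (_ : p' ∈ Finset.range n) => h1 p'
    simp only [Finset.sum_add_distrib, Finset.sum_ite_eq', Finset.mem_range] at h3
    rw [h3]
    simp

theorem exists_output_layer (d : ℕ) : ∃ θ : TFLayer (4 * d + 8), θ.M = 2 ∧
    ∀ (n : ℕ) (S : ℝ) (U A V : ℕ → Fin d → ℝ) (x y w j : ℕ → ℝ) (q g : ℝ),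
      layerMap relu θ ((List.range n).map fun p =>
        mkTok ![U p, A p, V p, 0] ![y p, q, x p, g, 1, S, w p, j p]) =
      (List.range n).map fun p =>
        mkTok ![fun k => ∑ p' ∈ Finset.range n, q * y p' * V p' k, 0, 0, 0]
          ![0, 0, 0, 0, 1, S, g - S, j p + S] := by
  obtain ⟨θ, hM, hθ⟩ := exists_layer (D := 4 * d + 8) (M := 2) (act := relu)
    (fun m h h' => (![1, -1] : Fin 2 → ℝ) m * (scal h 1 * scal h' 0))
    (fun m h' => linmap) (fun m h => linmap)
    (fun m h' => mkTok ![0, 0, 0, fun k => (![1, -1] : Fin 2 → ℝ) m * blk h' 2 k] 0)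
    (fun m => by
      refine ⟨fun x y => tok_ext (fun a k => ?_) (by simp),
        fun c x => tok_ext (fun a k => ?_) (by simp)⟩ <;> fin_cases a <;> simp <;> ring)
    (fun h => mkTok ![blk h 3, 0, 0, 0]
      ![0, 0, 0, 0, scal h 4, scal h 5, scal h 3 - scal h 5, scal h 7 + scal h 5])
    (neuronSpan_of_coords (by
      intro a k
      refine linear_mem_neuronSpan ?_
      fin_cases a <;> simp <;> exact linmap) (by
      intro s
      refine linear_mem_neuronSpan ?_
      fin_cases s <;> simp <;> exact linmap))
  refine ⟨θ, hM, fun n S U A V x y w j q g => hθ n _ (fun p => mkTok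
    ![U p, A p, V p, fun k => ∑ p' ∈ Finset.range n, q * y p' * V p' k]
    ![y p, q, x p, g, 1, S, w p, j p]) _
    (fun p _ => tok_ext (fun a k => ?_) fun i => ?_)
    fun p hp => tok_ext (fun a k => ?_) fun i => ?_⟩
  · simp only [Fin.sum_univ_two]
    fin_cases a <;> simp
    simp only [← sub_eq_add_neg, ← Finset.sum_sub_distrib, ← sub_mul, relu_sub_relu_neg]
  · fin_cases i <;> simp
  · fin_cases a <;> simp
  · fin_cases i <;> simp

theorem exists_identity_layer (D : ℕ) : ∃ θ : TFLayer D, θ.M = 0 ∧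
    ∀ (n : ℕ) (f : ℕ → Fin D → ℝ),
      layerMap relu θ ((List.range n).map f) = (List.range n).map f := by
  obtain ⟨θ, hM, hθ⟩ := exists_layer (D := D) (M := 0) (act := relu)
    (fun m h h' => 0) (fun m h' => linmap) (fun m h => linmap)
    (fun m h' => 0) (fun m => ⟨by simp, by simp⟩) id (by simp [← Pi.zero_def, zero_mem])
  exact ⟨θ, hM, fun n f => hθ n f f f (by simp) fun _ _ => rfl⟩

theorem exists_forward_transformer (d : ℕ) : ∃ Θ : List (TFLayer (4 * d + 8)),
    Θ.length = 8 ∧ (∀ θ ∈ Θ, θ.M ≤ 8) ∧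
    ∀ (n s : ℕ) (S : ℝ) (U : ℕ → Fin d → ℝ) (w : ℕ → ℤ), 2 ≤ S → s < n →
      s + ((Finset.range n).filter fun p => w p = 0).card = n →
      (∀ p < n, ∀ k, |U p k| ≤ S) →
      tfForwardEUAF Θ ((List.range n).map fun p => promptToken d (U p) (w p) (p + 1) S) =
      (List.range n).map fun p => promptToken d
        (fun k => ∑ p' ∈ Finset.range n, if w p' = 1 - 2 * w s ∧ p' + 1 < n then
          U p' k * ∑ k', U (p' + 1) k' * euaf (U s k') else 0) (w s - 1) (p + 2) S := by
  obtain ⟨θ₁, hM₁, h₁⟩ := exists_activation_layer d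
  obtain ⟨θ₂, hM₂, h₂⟩ := exists_flag_layer d
  obtain ⟨θ₃, hM₃, h₃⟩ := exists_source_layer d
  obtain ⟨θ₄, hM₄, h₄⟩ := exists_inner_layer d
  obtain ⟨θ₅, hM₅, h₅⟩ := exists_shift_layer d
  obtain ⟨θ₆, hM₆, h₆⟩ := exists_output_layer d
  obtain ⟨θ₇, hM₇, h₇⟩ := exists_identity_layer (4 * d + 8)
  refine ⟨[θ₁, θ₂, θ₃, θ₄, θ₅, θ₆, θ₇, θ₇], rfl, by simp; omega, fun n s S U w hS hs hcard hU => ?_⟩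
  have hS0 : 0 ≤ S := by linarith
  have hc : (n : ℝ) - ((Finset.range n).filter fun p => w p = 0).card = s := by
    rw [sub_eq_iff_eq_add]
    exact_mod_cast hcard.symm
  simp only [promptToken_eq_mkTok, tfForwardEUAF, List.foldl_cons, List.foldl_nil, Nat.cast_add,
    Nat.cast_one]
  rw [h₁ n S U w hS, hc, h₂ n s S _ _ _ _ hS0,
    h₃ n s S U (fun p k => euaf (U p k)) w _ hS hs
      fun p _ k => (euaf_abs_le _).trans (by linarith),
    h₄ n s S U _ (fun p => w p + 2 * w s - 1 = 0) _ _ _ _ hS0 hs hU,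
    h₅ n S _ _ _ _ _ _ _ hS0, h₆, h₇, h₇]
  refine List.map_congr_left fun p _ => ?_
  congr 3
  · funext k
    refine Finset.sum_congr rfl fun p' _ => ?_
    have h : w p' + 2 * w s - 1 = 0 ↔ w p' = 1 - 2 * w s := by omega
    have hS1 : S ≠ 0 := by linarith
    simp only [h]
    by_cases h1 : w p' = 1 - 2 * w s <;> by_cases h2 : p' + 1 < n <;> simp [h1, h2, hS1]
    ring
  · push_cast
    congr 7
    · ring
    · ring

/-- A family of tokens reproduced by `forward` one token at a time is what `forward` generates. -/
lemma genTokens_eq_map_range {D : ℕ} {forward : List (Fin D → ℝ) → List (Fin D → ℝ)}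
    {f : ℕ → Fin D → ℝ} {n₀ n₁ : ℕ}
    (h : ∀ n, n₀ ≤ n → n < n₁ → (forward ((List.range n).map f)).getLastD (fun _ => 0) = f n) :
    ∀ v, n₀ + v ≤ n₁ →
      genTokens forward ((List.range n₀).map f) v = (List.range (n₀ + v)).map f
  | 0, _ => rfl
  | v + 1, hv => by
    rw [genTokens, genTokens_eq_map_range h v (by omega), h _ (by omega) (by omega), ← add_assoc,
      List.range_succ, List.map_append, List.map_singleton]

lemma sum_range_two_mul_ite {M : Type*} [AddCommMonoid M] (m : ℕ) (f : ℕ → M) :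
    ∑ q ∈ Finset.range (2 * m), (if q % 2 = 0 then f (q / 2) else 0) =
      ∑ k ∈ Finset.range m, f k := by
  induction m with
  | zero => simp
  | succ m ih =>
    rw [show 2 * (m + 1) = 2 * m + 1 + 1 by ring, Finset.sum_range_succ, Finset.sum_range_succ, ih,
      Finset.sum_range_succ, if_pos (by omega), if_neg (by omega), add_zero]
    congr 2
    omega

/-- Rank-one factors of all layers can be laid out as adjacent pairs in a prompt. -/
lemma exists_prompt {X : Type*} (r : ℕ → ℕ) (U : Set X) (a b : ℕ → ℕ → X) (x₀ : X) (L : ℕ)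
    (ha : ∀ ℓ, 1 ≤ ℓ → ℓ ≤ L → ∀ k < r ℓ, a ℓ k ∈ U)
    (hb : ∀ ℓ, 1 ≤ ℓ → ℓ ≤ L → ∀ k < r ℓ, b ℓ k ∈ U) :
    ∃ (u : ℕ → X) (w : ℕ → ℕ),
      (∀ p < 2 * ∑ ℓ ∈ Finset.Icc 1 L, r ℓ, u p ∈ U ∧ 1 ≤ w p ∧ w p ≤ 2 * L ∧
        (w p % 2 = 1 → p + 1 < 2 * ∑ ℓ ∈ Finset.Icc 1 L, r ℓ)) ∧
      ∀ ℓ < L, ∀ F : X → X → ℝ,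
        ∑ p ∈ Finset.range (2 * ∑ ℓ ∈ Finset.Icc 1 L, r ℓ),
          (if w p = 2 * ℓ + 1 then F (u p) (u (p + 1)) else 0) =
        ∑ k ∈ Finset.range (r (ℓ + 1)), F (a (ℓ + 1) k) (b (ℓ + 1) k) := by
  induction L with
  | zero => exact ⟨fun _ => x₀, fun _ => 0, by simp, by simp⟩
  | succ L ih =>
    obtain ⟨u, w, h1, h2⟩ := ih (fun ℓ h h' => ha ℓ h (by omega)) (fun ℓ h h' => hb ℓ h (by omega))
    rw [Finset.sum_Icc_succ_top (by omega), mul_add]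
    set T := 2 * ∑ ℓ ∈ Finset.Icc 1 L, r ℓ with hT
    have hT2 : T % 2 = 0 := by omega
    refine ⟨fun p => if p < T then u p else
        if (p - T) % 2 = 0 then a (L + 1) ((p - T) / 2) else b (L + 1) ((p - T) / 2),
      fun p => if p < T then w p else if (p - T) % 2 = 0 then 2 * L + 1 else 2 * L + 2,
      fun p hp => ?_, fun ℓ hℓ F => ?_⟩
    · by_cases hpT : p < T
      · obtain ⟨h3, h4, h5, h6⟩ := h1 p hpT
        simp only [hpT, if_true]
        exact ⟨h3, h4, by omega, fun h => by have := h6 h; omega⟩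
      · simp only [hpT, if_false]
        split_ifs with h
        · exact ⟨ha _ (by omega) le_rfl _ (by omega), by omega, by omega, fun _ => by omega⟩
        · exact ⟨hb _ (by omega) le_rfl _ (by omega), by omega, by omega, fun _ => by omega⟩
    · rw [Finset.sum_range_add]
      have hnew : ∀ q, (if (if T + q < T then w (T + q) else
          if (T + q - T) % 2 = 0 then 2 * L + 1 else 2 * L + 2) = 2 * ℓ + 1 then
          F (if T + q < T then u (T + q) else if (T + q - T) % 2 = 0 then
              a (L + 1) ((T + q - T) / 2) else b (L + 1) ((T + q - T) / 2))
            (if T + q + 1 < T then u (T + q + 1) else if (T + q + 1 - T) % 2 = 0 then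
              a (L + 1) ((T + q + 1 - T) / 2) else b (L + 1) ((T + q + 1 - T) / 2)) else 0) =
          if q % 2 = 0 then if ℓ = L then F (a (L + 1) (q / 2)) (b (L + 1) (q / 2)) else 0
          else 0 := by
        intro q
        rw [if_neg (by omega : ¬ T + q < T), if_neg (by omega : ¬ T + q < T),
          if_neg (by omega : ¬ T + q + 1 < T), show T + q - T = q by omega,
          show T + q + 1 - T = q + 1 by omega]
        by_cases hq : q % 2 = 0
        · rw [if_pos hq, if_pos hq, if_pos hq, if_neg (by omega : ¬ (q + 1) % 2 = 0),
            show (q + 1) / 2 = q / 2 by omega]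
          exact if_congr (by omega) rfl rfl
        · rw [if_neg hq, if_neg hq, if_neg (by omega), if_neg hq]
      rw [Finset.sum_congr rfl fun q _ => hnew q, sum_range_two_mul_ite (r (L + 1))
        fun k => if ℓ = L then F (a (L + 1) k) (b (L + 1) k) else 0]
      rcases Nat.lt_succ_iff_lt_or_eq.1 hℓ with hℓ | rfl
      · simp only [hℓ.ne, if_false, Finset.sum_const_zero, add_zero]
        rw [← h2 ℓ hℓ F]
        refine Finset.sum_congr rfl fun p hp => ?_
        rw [Finset.mem_range] at hp
        simp only [hp, if_true]
        by_cases h : w p = 2 * ℓ + 1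
        · rw [if_pos h, if_pos h, if_pos ((h1 p hp).2.2.2 (by omega))]
        · rw [if_neg h, if_neg h]
      · simp only [if_true]
        rw [Finset.sum_eq_zero, zero_add]
        intro p hp
        rw [Finset.mem_range] at hp
        have := (h1 p hp).2.2.1
        rw [if_pos hp, if_neg (by omega)]

lemma abs_apply_le_of_mem_eball {v : Fin d → ℝ} {B : ℝ} (hv : v ∈ eball d B) (k : Fin d) :
    |v k| ≤ B := by
  refine le_trans ?_ hv
  rw [← Real.sqrt_sq_eq_abs]
  exact Real.sqrt_le_sqrt (Finset.single_le_sum (f := fun k => v k ^ 2)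
    (fun _ _ => sq_nonneg _) (Finset.mem_univ k))

lemma vnetOut_euaf_succ (W : ℕ → Matrix (Fin d) (Fin d) ℝ) {z : Fin d → ℝ}
    (hz : ∀ k, z k ∈ Set.Icc (0 : ℝ) 1) (ℓ : ℕ) :
    vnetOut d euaf W z (ℓ + 1) = (W (ℓ + 1)).mulVec fun k => euaf (vnetOut d euaf W z ℓ k) := by
  rw [vnetOut]
  congr 1
  funext k
  split_ifs with h
  · subst h
    exact (euaf_of_mem_Icc (hz k)).symm
  · rfl

lemma sum_vecMulVec_mulVec {α : Type*} (t : Finset α) (a b : α → Fin d → ℝ) (x : Fin d → ℝ)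
    (k : Fin d) :
    (∑ j ∈ t, vecMulVec (a j) (b j)).mulVec x k = ∑ j ∈ t, a j k * ∑ k', b j k' * x k' := by
  simp only [Matrix.mulVec, dotProduct, Matrix.sum_apply, vecMulVec_apply, Finset.sum_mul,
    Finset.mul_sum, mul_assoc]
  rw [Finset.sum_comm]

lemma abs_sum_mul_sum_le {α : Type*} (t : Finset α) (a b : α → Fin d → ℝ) (x : Fin d → ℝ) {B : ℝ}
    (hB : 0 ≤ B) (ha : ∀ j ∈ t, ∀ k, |a j k| ≤ B) (hb : ∀ j ∈ t, ∀ k, |b j k| ≤ B)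
    (hx : ∀ k, |x k| ≤ 1) (k : Fin d) :
    |∑ j ∈ t, a j k * ∑ k', b j k' * x k'| ≤ d * t.card * B ^ 2 := by
  have h1 : ∀ j ∈ t, |a j k * ∑ k', b j k' * x k'| ≤ B * (d * B) := by
    intro j hj
    rw [abs_mul]
    refine mul_le_mul (ha j hj k) ?_ (abs_nonneg _) hB
    refine (Finset.abs_sum_le_sum_abs _ _).trans ?_
    have : ∀ k' ∈ (Finset.univ : Finset (Fin d)), |b j k' * x k'| ≤ B := fun k' _ => by
      rw [abs_mul]
      nlinarith [hb j hj k', hx k', abs_nonneg (x k'), abs_nonneg (b j k')]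
    simpa using Finset.sum_le_sum this
  refine (Finset.abs_sum_le_sum_abs _ _).trans ((Finset.sum_le_sum h1).trans_eq ?_)
  simp
  ring

lemma exists_factors {B : ℝ} {L : ℕ} {r : ℕ → ℕ} {U : Set (Fin d → ℝ)}
    {W : ℕ → Matrix (Fin d) (Fin d) ℝ}
    (hW : ∀ ℓ, 1 ≤ ℓ → ℓ ≤ L → W ℓ ∈ coarseW d (r ℓ) U B) (ℓ : ℕ) :
    ∃ a b : ℕ → Fin d → ℝ, 1 ≤ ℓ → ℓ ≤ L → (∀ k < r ℓ, a k ∈ U) ∧ (∀ k < r ℓ, b k ∈ U) ∧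
      W ℓ = ∑ k ∈ Finset.range (r ℓ), vecMulVec (a k) (b k) := by
  by_cases h : 1 ≤ ℓ ∧ ℓ ≤ L
  · obtain ⟨⟨ut, uu, h1, h2, h3⟩, -⟩ := hW ℓ h.1 h.2
    refine ⟨fun k => if hk : k < r ℓ then ut ⟨k, hk⟩ else 0,
      fun k => if hk : k < r ℓ then uu ⟨k, hk⟩ else 0, fun _ _ =>
      ⟨fun k hk => by simp [hk, h1], fun k hk => by simp [hk, h2], ?_⟩⟩
    rw [h3, Finset.sum_range]
    simp
  · exact ⟨0, 0, fun h1 h2 => absurd ⟨h1, h2⟩ h⟩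

end PromptTF

/-- A fixed `8`-layer EUAF-transformer with at most `8` heads per layer that,
given a suitable prompt, exactly emulates any coarse EUAF neural network with weight matrices
`W_ℓ ∈ W(r_ℓ, d, U, B)`, on any data tokens. -/
theorem statement_7 (d : ℕ) (hd : 0 < d) :
    ∃ Θ : List (TFLayer (4 * d + 8)),
      Θ.length = 8 ∧ (∀ θ ∈ Θ, θ.M ≤ 8) ∧
      ∀ B : ℝ, 1 ≤ B → ∀ L : ℕ, 0 < L →
      ∀ (r : ℕ → ℕ) (U : Set (Fin d → ℝ)), U ⊆ eball d B →
      ∀ W : ℕ → Matrix (Fin d) (Fin d) ℝ,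
        (∀ ℓ, 1 ≤ ℓ → ℓ ≤ L → W ℓ ∈ coarseW d (r ℓ) U B) →
      ∀ S : ℝ,
        max ((d : ℝ) * (((Finset.Icc 1 L).sup r : ℕ) : ℝ) * B ^ (4 * L)) (2 * (L : ℝ)) ≤ S →
      ∀ T : ℕ, T = 2 * ∑ ℓ ∈ Finset.Icc 1 L, r ℓ →
        ∃ (u : Fin T → Fin d → ℝ) (w : Fin T → ℕ),
          ValidPrompt U T L u w ∧
          ∀ N : ℕ, 0 < N → ∀ z : Fin N → Fin d → ℝ,
            (∀ i k, z i k ∈ Set.Icc (0 : ℝ) 1) →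
          ∀ (i : Fin N) (ℓ : ℕ), 1 ≤ ℓ → ℓ ≤ L →
            tokenAt (tfForwardEUAF Θ) (initialInput d T N u w S z) (T + N * ℓ + (i : ℕ) + 1)
              = promptToken d (vnetOut d euaf W (z i) ℓ) (-(ℓ : ℤ))
                  (T + N * ℓ + (i : ℕ) + 1) S := by
  obtain ⟨Θ, hlen, hM, hΘ⟩ := exists_forward_transformer d
  refine ⟨Θ, hlen, hM, fun B hB L hL r U hU W hW S hS T hT => ?_⟩
  choose a b hab using exists_factors hW
  obtain ⟨u, w, hp, hsum⟩ := exists_prompt r U a b 0 L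
    (fun ℓ h h' => (hab ℓ h h').1) (fun ℓ h h' => (hab ℓ h h').2.1)
  rw [← hT] at hp hsum
  refine ⟨fun j => u j, fun j => w j,
    ⟨fun j => (hp j j.2).1, fun j => ⟨(hp j j.2).2.1, (hp j j.2).2.2.1⟩⟩,
    fun N hN z hz i ℓ hℓ hℓL => ?_⟩
  have hLS : 2 * (L : ℝ) ≤ S := (le_max_right _ _).trans hS
  have hL1 : (1 : ℝ) ≤ L := by exact_mod_cast hL
  have hS2 : 2 ≤ S := by linarith
  have hBS : ∀ m, 1 ≤ m → m ≤ L → (d : ℝ) * r m * B ^ 2 ≤ S := by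
    intro m hm hmL
    refine le_trans ?_ ((le_max_left _ _).trans hS)
    have h1 : (r m : ℝ) ≤ (((Finset.Icc 1 L).sup r : ℕ) : ℝ) := by
      exact_mod_cast Finset.le_sup (f := r) (Finset.mem_Icc.2 ⟨hm, hmL⟩)
    have h2 : B ^ 2 ≤ B ^ (4 * L) := pow_le_pow_right₀ hB (by omega)
    gcongr
  have hu : ∀ p < T, ∀ k, |u p k| ≤ S := by
    intro p hpT k
    refine (abs_apply_le_of_mem_eball (hU (hp p hpT).1) k).trans ?_
    obtain ⟨m, hm, hr⟩ : ∃ m ∈ Finset.Icc 1 L, r m ≠ 0 := by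
      by_contra! h
      rw [Finset.sum_eq_zero h] at hT
      omega
    rw [Finset.mem_Icc] at hm
    refine le_trans ?_ (hBS m hm.1 hm.2)
    have h1 : (1 : ℝ) ≤ d * r m := by exact_mod_cast Nat.mul_pos hd (Nat.pos_of_ne_zero hr)
    nlinarith
  have hWx : ∀ m < L, ∀ (x : Fin d → ℝ) k, (W (m + 1)).mulVec x k =
      ∑ j ∈ Finset.range (r (m + 1)), a (m + 1) j k * ∑ k', b (m + 1) j k' * x k' := by
    intro m hm x k
    rw [(hab (m + 1) (by omega) (by omega)).2.2, sum_vecMulVec_mulVec]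
  have hv : ∀ i, ∀ m ≤ L, ∀ k, |vnetOut d euaf W (z i) m k| ≤ S := by
    intro i m hm k
    rcases m with _ | m
    · rw [vnetOut, abs_of_nonneg (hz i k).1]
      linarith [(hz i k).2]
    · rw [vnetOut_euaf_succ W (hz i), hWx m (by omega)]
      have hm1 := hab (m + 1) (by omega) hm
      refine (abs_sum_mul_sum_le _ _ _ _ (by linarith : 0 ≤ B)
        (fun j hj => abs_apply_le_of_mem_eball (hU (hm1.1 j (Finset.mem_range.1 hj))))
        (fun j hj => abs_apply_le_of_mem_eball (hU (hm1.2.1 j (Finset.mem_range.1 hj))))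
        (fun k' => euaf_abs_le _) k).trans ?_
      rw [Finset.card_range]
      exact hBS _ (by omega) hm
  set Y : ℕ → Fin d → ℝ := fun p => if p < T then u p else
    vnetOut d euaf W (z ⟨(p - T) % N, Nat.mod_lt _ hN⟩) ((p - T) / N) with hY
  set ω : ℕ → ℤ := fun p => if p < T then (w p : ℤ) else -(((p - T) / N : ℕ) : ℤ) with hω
  set f : ℕ → Fin (4 * d + 8) → ℝ := fun p => promptToken d (Y p) (ω p) (p + 1) S with hf
  have hinit : initialInput d T N (fun j => u j) (fun j => w j) S z = (List.range (T + N)).map f := by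
    rw [initialInput, List.range_add, List.map_append, ← List.map_coe_finRange_eq_range (n := T),
      ← List.map_coe_finRange_eq_range (n := N), List.map_map, List.map_map, List.map_map]
    congr 1
    · refine List.map_congr_left fun j _ => ?_
      simp [hf, hY, hω]
    · refine List.map_congr_left fun j _ => ?_
      simp [hf, hY, hω, Nat.mod_eq_of_lt j.2, Nat.div_eq_of_lt j.2, vnetOut, -Int.natCast_ediv]
  have hstep : ∀ n, T + N ≤ n → n < T + N * (L + 1) →
      (tfForwardEUAF Θ ((List.range n).map f)).getLastD (fun _ => 0) = f n := by
    intro n hn hnL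
    obtain ⟨q, rfl⟩ : ∃ q, n = T + q + N := ⟨n - N - T, by omega⟩
    have hqL : q / N < L := by
      rw [Nat.div_lt_iff_lt_mul hN]
      rw [mul_add, mul_comm] at hnL
      omega
    have hωs : ω (T + q) = -((q / N : ℕ) : ℤ) := by simp [hω]
    have hYs : Y (T + q) = vnetOut d euaf W (z ⟨q % N, Nat.mod_lt _ hN⟩) (q / N) := by
      simp [hY]
    have hcard : T + q + ((Finset.range (T + q + N)).filter fun p => ω p = 0).card =
        T + q + N := by
      have : ((Finset.range (T + q + N)).filter fun p => ω p = 0) = Finset.Ico T (T + N) := by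
        ext p
        simp only [Finset.mem_filter, Finset.mem_range, Finset.mem_Ico, hω]
        by_cases hpT : p < T
        · have := (hp p hpT).2.1
          simp only [hpT, if_true]
          omega
        · simp only [hpT, if_false, neg_eq_zero, Nat.cast_eq_zero, Nat.div_eq_zero_iff]
          omega
      simp [this]
    have hYS : ∀ p < T + q + N, ∀ k, |Y p k| ≤ S := by
      intro p hpn k
      by_cases hpT : p < T
      · simpa [hY, hpT] using hu p hpT k
      · have : (p - T) / N ≤ L := by
          refine Nat.lt_succ_iff.1 ((Nat.div_lt_iff_lt_mul hN).2 ?_)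
          rw [Nat.succ_eq_add_one, mul_comm]
          omega
        simpa [hY, hpT] using hv _ _ this k
    rw [hf, hΘ (T + q + N) (T + q) S Y ω hS2 (by omega) hcard hYS]
    obtain ⟨n', hn'⟩ : ∃ n', T + q + N = n' + 1 := ⟨T + q + N - 1, by omega⟩
    have hlast : ∀ g : ℕ → Fin (4 * d + 8) → ℝ,
        ((List.range (T + q + N)).map g).getLastD (fun _ => 0) = g n' := by
      intro g
      rw [hn', List.range_succ]
      simp
    rw [hlast, ← show T + q + N + 1 = n' + 2 by omega]
    have hdiv : (T + q + N - T) / N = q / N + 1 := by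
      rw [show T + q + N - T = q + N by omega, Nat.add_div_right _ hN]
    have hmod : (T + q + N - T) % N = q % N := by
      rw [show T + q + N - T = q + N by omega, Nat.add_mod_right]
    have hωn : ω (T + q + N) = ω (T + q) - 1 := by
      rw [hωs]
      simp only [hω, hdiv]
      rw [if_neg (by omega)]
      push_cast
      ring
    have hYn : Y (T + q + N) =
        vnetOut d euaf W (z ⟨q % N, Nat.mod_lt _ hN⟩) (q / N + 1) := by
      simp only [hY, hdiv, hmod]
      rw [if_neg (by omega)]
    simp only [hωn, hYn]
    rw [vnetOut_euaf_succ W (hz _)]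
    congr 1
    funext k
    rw [hWx _ hqL, ← hsum _ hqL fun x y => x k * ∑ k', y k' *
        euaf (vnetOut d euaf W (z ⟨q % N, Nat.mod_lt _ hN⟩) (q / N) k'),
      show T + q + N = T + (q + N) by ring, Finset.sum_range_add, hωs, hYs,
      Finset.sum_eq_zero (s := Finset.range (q + N)), add_zero]
    · refine Finset.sum_congr rfl fun p hpT => ?_
      rw [Finset.mem_range] at hpT
      have hωp : ω p = w p := by simp [hω, hpT]
      have hYp : Y p = u p := by simp [hY, hpT]
      rw [hωp, hYp]
      by_cases h : w p = 2 * (q / N) + 1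
      · have hp1 := (hp p hpT).2.2.2 (by omega)
        have hYp1 : Y (p + 1) = u (p + 1) := by simp [hY, hp1]
        rw [if_pos h, if_pos ⟨by omega, by omega⟩, hYp1]
      · rw [if_neg h, if_neg (by omega)]
    · intro p _
      have hωp : ω (T + p) = -((p / N : ℕ) : ℤ) := by simp [hω]
      have hne : ∀ x y : ℕ, -(x : ℤ) ≠ 1 - 2 * -(y : ℤ) := by omega
      rw [hωp, if_neg fun h => hne _ _ h.1]
  have hiN := i.2
  have hNℓ : N ≤ N * ℓ := Nat.le_mul_of_pos_right N hℓ
  have hNL : N * ℓ ≤ N * L := Nat.mul_le_mul_left N hℓL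
  have hmod : (N * ℓ + (i : ℕ)) % N = i := by rw [Nat.mul_add_mod, Nat.mod_eq_of_lt hiN]
  have hdiv : (N * ℓ + (i : ℕ)) / N = ℓ := by
    rw [Nat.mul_add_div hN, Nat.div_eq_of_lt hiN, add_zero]
  rw [tokenAt, hinit, List.length_map, List.length_range,
    genTokens_eq_map_range hstep _ (by rw [mul_add]; omega),
    show T + N + (T + N * ℓ + (i : ℕ) + 1 - (T + N)) = T + N * ℓ + i + 1 by omega,
    Nat.add_sub_cancel, List.getD_eq_getElem _ _ (by simp), List.getElem_map, List.getElem_range]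
  have h1 : T + N * ℓ + (i : ℕ) - T = N * ℓ + i := by omega
  have h2 : ¬ T + N * ℓ + (i : ℕ) < T := by omega
  simp only [hf, hY, hω, h1, h2, hmod, hdiv, if_false]
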